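/- arXiv:2212.14373 — 3 statements merged into one kernel-verified Lean document; each statement's English description precedes it below -/
import Mathlib

section
/- Let u and w be two linearly independent vectors in ℝ², and let x = s·u + t·w with s, t ∈ (0,1) be any point in the open parallelogram spanned by u and w. Then the minimum of the Euclidean distances from x to the four vertices 0, u, w, u+w is strictly less than max(‖u‖, ‖w‖). -/
/-- The variance of a random vertex of the parallelogram spanned by `u` and `w`, with independent
Bernoulli coordinates of parameters `s` and `t`, about its mean `s • u + t • w`. -/
theorem weighted_sum_sq_dist_parallelogram_vertices {E : Type*} [NormedAddCommGroup E]
    [InnerProductSpace ℝ E] (u w : E) (s t : ℝ) :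
    (1 - s) * (1 - t) * ‖s • u + t • w‖ ^ 2 + s * (1 - t) * ‖s • u + t • w - u‖ ^ 2 +
      (1 - s) * t * ‖s • u + t • w - w‖ ^ 2 + s * t * ‖s • u + t • w - (u + w)‖ ^ 2 =
      s * (1 - s) * ‖u‖ ^ 2 + t * (1 - t) * ‖w‖ ^ 2 := by
  have key (a b : ℝ) :
      ‖a • u + b • w‖ ^ 2 = a ^ 2 * ‖u‖ ^ 2 + 2 * (a * b * inner ℝ u w) + b ^ 2 * ‖w‖ ^ 2 := by
    rw [norm_add_sq_real, real_inner_smul_left, real_inner_smul_right, norm_smul, norm_smul,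
      mul_pow, mul_pow, Real.norm_eq_abs, Real.norm_eq_abs, sq_abs, sq_abs]
    ring
  have hu : s • u + t • w - u = (s - 1) • u + t • w := by module
  have hw : s • u + t • w - w = s • u + (t - 1) • w := by module
  have huw : s • u + t • w - (u + w) = (s - 1) • u + (t - 1) • w := by module
  rw [hu, hw, huw, key, key, key, key]
  ring

/-- For linearly independent `u, w : ℝ²` and `x = s•u + t•w` with
`s, t ∈ (0,1)`, the minimum of the distances from `x` to the four vertices
`0, u, w, u+w` of the parallelogram is strictly less than `max ‖u‖ ‖w‖`. -/
theorem min_dist_to_parallelogram_vertices_lt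
    (u w : EuclideanSpace ℝ (Fin 2)) (hind : LinearIndependent ℝ ![u, w])
    (s t : ℝ) (hs : s ∈ Set.Ioo (0 : ℝ) 1) (ht : t ∈ Set.Ioo (0 : ℝ) 1)
    (x : EuclideanSpace ℝ (Fin 2)) (hx : x = s • u + t • w) :
    min (min ‖x - 0‖ ‖x - u‖) (min ‖x - w‖ ‖x - (u + w)‖) < max ‖u‖ ‖w‖ := by
  obtain ⟨hs0, hs1⟩ := hs
  obtain ⟨ht0, ht1⟩ := ht
  by_contra! hle
  simp only [le_min_iff, sub_zero] at hle
  obtain ⟨⟨h0, hu⟩, hw, huw⟩ := hle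
  have hM : 0 < max ‖u‖ ‖w‖ := lt_max_of_lt_left (norm_pos_iff.mpr (hind.ne_zero 0))
  have hvar := weighted_sum_sq_dist_parallelogram_vertices u w s t
  rw [← hx] at hvar
  have huM : ‖u‖ ≤ max ‖u‖ ‖w‖ := le_max_left _ _
  have hwM : ‖w‖ ≤ max ‖u‖ ‖w‖ := le_max_right _ _
  generalize max ‖u‖ ‖w‖ = M at *
  have hs' : 0 < 1 - s := sub_pos.mpr hs1
  have ht' : 0 < 1 - t := sub_pos.mpr ht1
  have lower : M ^ 2 ≤ s * (1 - s) * ‖u‖ ^ 2 + t * (1 - t) * ‖w‖ ^ 2 := by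
    rw [← hvar]
    calc M ^ 2 = (1 - s) * (1 - t) * M ^ 2 + s * (1 - t) * M ^ 2 +
          (1 - s) * t * M ^ 2 + s * t * M ^ 2 := by ring
      _ ≤ _ := by gcongr
  have upper : s * (1 - s) * ‖u‖ ^ 2 + t * (1 - t) * ‖w‖ ^ 2 ≤
      s * (1 - s) * M ^ 2 + t * (1 - t) * M ^ 2 := by gcongr
  have hcoef : s * (1 - s) + t * (1 - t) < 1 := by
    nlinarith [sq_nonneg (s - 1 / 2), sq_nonneg (t - 1 / 2)]
  nlinarith [mul_lt_mul_of_pos_right hcoef (pow_pos hM 2)]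
end

section
/- Let v₁, v₂, v₃ be three linearly independent vectors in ℝ³, and let x = t₁v₁ + t₂v₂ + t₃v₃ with t₁, t₂, t₃ ∈ (0,1) be any point in the open parallelepiped spanned by v₁, v₂, v₃. Then there exists a vertex w ∈ {n₁v₁ + n₂v₂ + n₃v₃ : n₁, n₂, n₃ ∈ {0,1}} such that ‖x − w‖ < max(‖v₁‖, ‖v₂‖, ‖v₃‖). -/
/-- Rounding a coefficient `t ∈ (0,1)` to a suitable `n ∈ {0,1}` adds at most `‖v‖² / 4` to the
squared norm: averaging over `n = 1` with weight `t` and `n = 0` with weight `1 - t` adds exactly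
`t (1 - t) ‖v‖²`. -/
theorem exists_norm_add_sub_smul_sq_le {E : Type*} [NormedAddCommGroup E] [InnerProductSpace ℝ E]
    (y v : E) {t : ℝ} (ht : t ∈ Set.Ioo (0 : ℝ) 1) :
    ∃ n : ℕ, n ≤ 1 ∧ ‖y + (t - n) • v‖ ^ 2 ≤ ‖y‖ ^ 2 + ‖v‖ ^ 2 / 4 := by
  obtain ⟨h0, h1⟩ := ht
  have expand (s : ℝ) :
      ‖y + s • v‖ ^ 2 = ‖y‖ ^ 2 + 2 * s * inner ℝ y v + s ^ 2 * ‖v‖ ^ 2 := by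
    rw [norm_add_sq_real, inner_smul_right, norm_smul, mul_pow, Real.norm_eq_abs, sq_abs]
    ring
  have quarter : t * (1 - t) * ‖v‖ ^ 2 ≤ ‖v‖ ^ 2 / 4 := by
    nlinarith [mul_nonneg (sq_nonneg (2 * t - 1)) (sq_nonneg ‖v‖)]
  by_contra! h
  have hzero := h 0 zero_le_one
  have hone := h 1 le_rfl
  rw [expand] at hzero hone
  push_cast at hzero hone
  nlinarith [mul_lt_mul_of_pos_left hzero (sub_pos.mpr h1), mul_lt_mul_of_pos_left hone h0]


/-- For linearly independent `v₁, v₂, v₃ : ℝ³` and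
`x = t₁v₁ + t₂v₂ + t₃v₃` with `t₁, t₂, t₃ ∈ (0,1)`, there is a vertex
`w = n₁v₁ + n₂v₂ + n₃v₃` (with `nᵢ ∈ {0,1}`) of the parallelepiped such that
`‖x − w‖ < max(‖v₁‖, ‖v₂‖, ‖v₃‖)`. -/
theorem exists_vertex_dist_lt_of_mem_open_parallelepiped
    (v₁ v₂ v₃ : EuclideanSpace ℝ (Fin 3)) (hind : LinearIndependent ℝ ![v₁, v₂, v₃])
    (t₁ t₂ t₃ : ℝ) (ht₁ : t₁ ∈ Set.Ioo (0 : ℝ) 1) (ht₂ : t₂ ∈ Set.Ioo (0 : ℝ) 1)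
    (ht₃ : t₃ ∈ Set.Ioo (0 : ℝ) 1)
    (x : EuclideanSpace ℝ (Fin 3)) (hx : x = t₁ • v₁ + t₂ • v₂ + t₃ • v₃) :
    ∃ n₁ n₂ n₃ : ℕ, n₁ ≤ 1 ∧ n₂ ≤ 1 ∧ n₃ ≤ 1 ∧
      ‖x - ((n₁ : ℝ) • v₁ + (n₂ : ℝ) • v₂ + (n₃ : ℝ) • v₃)‖ < max ‖v₁‖ (max ‖v₂‖ ‖v₃‖) := by
  obtain ⟨n₁, hn₁, h₁⟩ := exists_norm_add_sub_smul_sq_le 0 v₁ ht₁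
  obtain ⟨n₂, hn₂, h₂⟩ := exists_norm_add_sub_smul_sq_le (0 + (t₁ - n₁) • v₁) v₂ ht₂
  obtain ⟨n₃, hn₃, h₃⟩ :=
    exists_norm_add_sub_smul_sq_le (0 + (t₁ - n₁) • v₁ + (t₂ - n₂) • v₂) v₃ ht₃
  refine ⟨n₁, n₂, n₃, hn₁, hn₂, hn₃, ?_⟩
  have hsub : x - ((n₁ : ℝ) • v₁ + (n₂ : ℝ) • v₂ + (n₃ : ℝ) • v₃) =
      0 + (t₁ - n₁) • v₁ + (t₂ - n₂) • v₂ + (t₃ - n₃) • v₃ := by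
    rw [hx]
    module
  rw [hsub]
  set M := max ‖v₁‖ (max ‖v₂‖ ‖v₃‖)
  have hM₁ : ‖v₁‖ ≤ M := le_max_left _ _
  have hM₂ : ‖v₂‖ ≤ M := (le_max_left _ _).trans (le_max_right _ _)
  have hM₃ : ‖v₃‖ ≤ M := (le_max_right _ _).trans (le_max_right _ _)
  have hM : 0 < M := (norm_pos_iff.mpr (hind.ne_zero 0)).trans_le hM₁
  refine lt_of_pow_lt_pow_left₀ 2 hM.le ?_
  have hsq₁ : ‖v₁‖ ^ 2 ≤ M ^ 2 := by gcongr
  have hsq₂ : ‖v₂‖ ^ 2 ≤ M ^ 2 := by gcongr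
  have hsq₃ : ‖v₃‖ ^ 2 ≤ M ^ 2 := by gcongr
  have hMsq : 0 < M ^ 2 := by positivity
  have hnorm : ‖(0 : EuclideanSpace ℝ (Fin 3))‖ ^ 2 = 0 := by simp
  linarith
end

section
/- Let v₁, v₂, v₃, v₄ be vectors in ℝ^d and let v = t₁v₁ + t₂v₂ + t₃v₃ + t₄v₄ with t₁, t₂, t₃, t₄ ∈ [0,1). Then there exists a vertex v₀ ∈ {n₁v₁ + n₂v₂ + n₃v₃ + n₄v₄ : n_i ∈ {0,1}} such that ‖v − v₀‖² ≤ (1/4)(‖v₁‖² + ‖v₂‖² + ‖v₃‖² + ‖v₄‖²). In fact, assigning to each vertex v₀ = ∑ n_i v_i the weight w(v₀) = ∏_{i=1}^4 ((2t_i − 1)n_i + (1 − t_i)), one has the identity ∑_{v₀} w(v₀)·‖v − v₀‖² = ∑_{i=1}^4 t_i(1 − t_i)‖v_i‖², and the weights are nonnegative and sum to 1. -/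
/-- The mean squared length of a two-valued perturbation of `y` in direction `v`. -/
lemma weighted_norm_sq_add_smul {E : Type*} [NormedAddCommGroup E] [InnerProductSpace ℝ E]
    (y v : E) (t : ℝ) :
    (1 - t) * ‖y + t • v‖ ^ 2 + t * ‖y + (t - 1) • v‖ ^ 2 = ‖y‖ ^ 2 + t * (1 - t) * ‖v‖ ^ 2 := by
  simp only [norm_add_sq_real, inner_smul_right, norm_smul, mul_pow, Real.norm_eq_abs, sq_abs]
  ring

/-- The vertex weights are nonnegative. -/
lemma prod_vertex_weight_nonneg {ι : Type*} [Fintype ι] {t : ι → ℝ}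
    (ht : ∀ i, t i ∈ Set.Icc (0 : ℝ) 1) (n : ι → Fin 2) :
    0 ≤ ∏ i, ((2 * t i - 1) * ((n i : ℕ) : ℝ) + (1 - t i)) := by
  refine Finset.prod_nonneg fun i _ => ?_
  obtain ⟨h0, h1⟩ := ht i
  generalize n i = j
  fin_cases j <;> norm_num <;> linarith

/-- The vertex weights sum to `1`. -/
lemma sum_prod_vertex_weight {ι : Type*} [Fintype ι] [DecidableEq ι] (t : ι → ℝ) :
    ∑ n : ι → Fin 2, ∏ i, ((2 * t i - 1) * ((n i : ℕ) : ℝ) + (1 - t i)) = 1 := by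
  rw [← Fintype.piFinset_univ, ← Finset.prod_univ_sum (fun _ => Finset.univ)
    fun i (j : Fin 2) => (2 * t i - 1) * ((j : ℕ) : ℝ) + (1 - t i)]
  refine Finset.prod_eq_one fun i _ => ?_
  simp only [Fin.sum_univ_two, Fin.val_zero, Fin.val_one, Nat.cast_zero, Nat.cast_one]
  ring

/-- The weighted mean of the squared distances to the vertices of a parallelepiped,
with an arbitrary offset `y`. -/
lemma sum_vertex_weight_mul_norm_sq {E : Type*} [NormedAddCommGroup E] [InnerProductSpace ℝ E]
    (k : ℕ) (v : Fin k → E) (t : Fin k → ℝ) (y : E) :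
    ∑ n : Fin k → Fin 2, (∏ i, ((2 * t i - 1) * ((n i : ℕ) : ℝ) + (1 - t i))) *
        ‖y + ∑ i, (t i - ((n i : ℕ) : ℝ)) • v i‖ ^ 2
      = ‖y‖ ^ 2 + ∑ i, t i * (1 - t i) * ‖v i‖ ^ 2 := by
  induction k generalizing y with
  | zero => simp
  | succ k ih =>
    rw [← (Fin.consEquiv fun _ => Fin 2).sum_comp, Fintype.sum_prod_type]
    simp only [Fin.consEquiv_apply, Fin.prod_univ_succ, Fin.sum_univ_succ (n := k), Fin.cons_zero,
      Fin.cons_succ, ← add_assoc, mul_assoc, ← Finset.mul_sum]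
    have key := fun z => ih (fun i => v i.succ) (fun i => t i.succ) z
    simp only [mul_assoc] at key
    simp only [key, Fin.sum_univ_two, Fin.val_zero, Fin.val_one, Nat.cast_zero, Nat.cast_one,
      sub_zero]
    linear_combination weighted_norm_sq_add_smul y (v 0) (t 0)

/-- For `v₁, v₂, v₃, v₄ ∈ ℝ^d` and `v = ∑ tᵢvᵢ` with `tᵢ ∈ [0,1)`,
some vertex `v₀ = ∑ nᵢvᵢ` (`nᵢ ∈ {0,1}`) satisfies
`‖v − v₀‖² ≤ (1/4)∑‖vᵢ‖²`; moreover with weights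
`w(v₀) = ∏ᵢ ((2tᵢ − 1)nᵢ + (1 − tᵢ))` one has
`∑_{v₀} w(v₀)‖v − v₀‖² = ∑ᵢ tᵢ(1 − tᵢ)‖vᵢ‖²`, the weights are nonnegative and
sum to `1`. -/
theorem weighted_sum_sq_dist_to_vertices
    (d : ℕ) (v : Fin 4 → EuclideanSpace ℝ (Fin d)) (t : Fin 4 → ℝ)
    (ht : ∀ i, t i ∈ Set.Ico (0 : ℝ) 1)
    (x : EuclideanSpace ℝ (Fin d)) (hx : x = ∑ i, t i • v i) :
    (∃ n : Fin 4 → Fin 2,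
        ‖x - ∑ i, ((n i : ℕ) : ℝ) • v i‖ ^ 2 ≤ (1 / 4) * ∑ i, ‖v i‖ ^ 2) ∧
    (∑ n : Fin 4 → Fin 2,
        (∏ i, ((2 * t i - 1) * ((n i : ℕ) : ℝ) + (1 - t i))) *
          ‖x - ∑ i, ((n i : ℕ) : ℝ) • v i‖ ^ 2
      = ∑ i, t i * (1 - t i) * ‖v i‖ ^ 2) ∧
    (∀ n : Fin 4 → Fin 2, 0 ≤ ∏ i, ((2 * t i - 1) * ((n i : ℕ) : ℝ) + (1 - t i))) ∧
    (∑ n : Fin 4 → Fin 2, ∏ i, ((2 * t i - 1) * ((n i : ℕ) : ℝ) + (1 - t i)) = 1) := by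
  have hw := prod_vertex_weight_nonneg fun i => Set.Ico_subset_Icc_self (ht i)
  have hsum := sum_prod_vertex_weight t
  have hid : ∑ n : Fin 4 → Fin 2, (∏ i, ((2 * t i - 1) * ((n i : ℕ) : ℝ) + (1 - t i))) *
      ‖x - ∑ i, ((n i : ℕ) : ℝ) • v i‖ ^ 2 = ∑ i, t i * (1 - t i) * ‖v i‖ ^ 2 := by
    simpa [hx, sub_smul, Finset.sum_sub_distrib] using sum_vertex_weight_mul_norm_sq 4 v t 0
  refine ⟨?_, hid, hw, hsum⟩
  by_contra! hfar
  have hle : ∑ i, t i * (1 - t i) * ‖v i‖ ^ 2 ≤ 1 / 4 * ∑ i, ‖v i‖ ^ 2 := by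
    rw [Finset.mul_sum]
    gcongr with i
    nlinarith [sq_nonneg (2 * t i - 1)]
  obtain ⟨m, -, hm⟩ := Finset.exists_ne_zero_of_sum_ne_zero (hsum.trans_ne one_ne_zero)
  have hlt := Finset.sum_lt_sum
    (fun n _ => mul_le_mul_of_nonneg_left (hfar n).le (hw n))
    ⟨m, Finset.mem_univ m, mul_lt_mul_of_pos_left (hfar m) ((hw m).lt_of_ne' hm)⟩
  rw [hid, ← Finset.sum_mul, hsum, one_mul] at hlt
  exact hlt.not_ge hle
end
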